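/- arXiv:2102.10481 — 4 statements merged into one kernel-verified Lean document; each statement's English description precedes it below -/
import Mathlib

section
/- Let A be a Dedekind domain with fraction field K. If A is Japanese (for every finite field extension L/K the integral closure of A in L is a finitely generated A-module), then A is universally Japanese: every finitely generated A-algebra R that is an integral domain is Japanese, i.e. for every finite field extension M of the fraction field of R, the integral closure of R in M is a finitely generated R-module. -/
universe u

open Polynomial in
/-- If `x ^ (q ^ m)` is a root of a separable polynomial over `F` whose coefficients have
`q ^ n`-th roots in the extension `E` of `F` with `m ≤ n`, then `x` is separable over `E`. -/
theorem isSeparable_of_aeval_expand_eq_zero {F E Ω : Type*} [Field F] [Field E] [Field Ω]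
    [Algebra F E] [Algebra E Ω] [Algebra F Ω] [IsScalarTower F E Ω] (q : ℕ) [ExpChar E q]
    {x : Ω} {g : F[X]} (hg : g.Separable) {m n : ℕ} (hmn : m ≤ n)
    (hx : aeval x (expand F (q ^ m) g) = 0)
    (hroot : ∀ i, ∃ e : E, e ^ q ^ n = algebraMap F E (g.coeff i)) : IsSeparable E x := by
  have hlift : g.map (algebraMap F E) ∈ lifts (iterateFrobenius E q m) := by
    rw [lifts_iff_coeff_lifts]
    intro i
    obtain ⟨e, he⟩ := hroot i
    refine ⟨e ^ q ^ (n - m), ?_⟩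
    rw [iterateFrobenius_def, ← pow_mul, ← pow_add, Nat.sub_add_cancel hmn, he, coeff_map]
  obtain ⟨h, hh⟩ := (mem_lifts _).mp hlift
  have hsep : h.Separable := by
    rw [← separable_map (iterateFrobenius E q m), hh]
    exact hg.map
  have hpow : h ^ q ^ m = (expand F (q ^ m) g).map (algebraMap F E) := by
    rw [map_expand, ← hh, ← map_expand, map_iterateFrobenius_expand]
  have hzero : aeval x h = 0 := by
    have : (aeval x h) ^ q ^ m = 0 := by
      rw [← map_pow, hpow, aeval_map_algebraMap, hx]
    exact pow_eq_zero_iff (expChar_pow_pos E q m).ne' |>.mp this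
  exact hsep.of_dvd (minpoly.dvd E x hzero)

open Polynomial in
/-- A finite extension `M / F` becomes separable after base change to any field extension of `F`
containing sufficiently many `q`-power roots of finitely many elements of `F`. -/
theorem exists_finite_separable_extension_of_forall_exists_pow_eq (F M : Type u) [Field F]
    [Field M] [Algebra F M] [FiniteDimensional F M] (q : ℕ) [ExpChar F q] :
    ∃ (C : Finset F) (n : ℕ), ∀ (E : Type u) [Field E] [Algebra F E],
      (∀ c ∈ C, ∃ e : E, e ^ q ^ n = algebraMap F E c) →
      ∃ N : IntermediateField E (AlgebraicClosure E), FiniteDimensional E N ∧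
        Algebra.IsSeparable E N ∧ Nonempty (M →ₐ[F] N) := by
  classical
  let b := Module.finBasis F M
  have hb (i) : IsIntegral F (b i) := Algebra.IsIntegral.isIntegral _
  choose g hgs m hgm using fun i ↦ (minpoly.irreducible (hb i)).hasSeparableContraction q
  refine ⟨Finset.univ.biUnion fun i ↦ (g i).coeffs, Finset.univ.sup m, fun E _ _ hE ↦ ?_⟩
  have : ExpChar E q := expChar_of_injective_algebraMap (algebraMap F E).injective q
  let φ : M →ₐ[F] AlgebraicClosure E := IsAlgClosed.lift
  have hφ (i) : IsSeparable E (φ (b i)) := by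
    refine isSeparable_of_aeval_expand_eq_zero q (hgs i) (Finset.le_sup (f := m) (Finset.mem_univ i))
      ?_ fun j ↦ ?_
    · rw [hgm, aeval_algHom_apply, minpoly.aeval, map_zero]
    · by_cases hj : (g i).coeff j = 0
      · exact ⟨0, by rw [hj, map_zero, zero_pow (expChar_pow_pos E q _).ne']⟩
      · exact hE _ (Finset.mem_biUnion.mpr ⟨i, Finset.mem_univ i, coeff_mem_coeffs hj⟩)
  let N := IntermediateField.adjoin E (Set.range (φ ∘ b))
  refine ⟨N, IntermediateField.finiteDimensional_adjoin ?_, ?_, ⟨?_⟩⟩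
  · rintro _ ⟨i, rfl⟩
    exact (hφ i).isIntegral
  · rw [IntermediateField.isSeparable_adjoin_iff_isSeparable]
    rintro _ ⟨i, rfl⟩
    exact hφ i
  · have hN (x : M) : φ x ∈ N := by
      rw [← b.sum_repr x, map_sum]
      refine sum_mem fun i _ ↦ ?_
      rw [map_smul, ← algebraMap_smul E]
      exact N.smul_mem (IntermediateField.subset_adjoin _ _ ⟨i, rfl⟩)
    exact φ.codRestrict (N.restrictScalars F).toSubalgebra hN

instance MvPolynomial.isIntegrallyClosed_fin {R : Type*} [CommRing R] [IsDomain R]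
    [IsIntegrallyClosed R] (n : ℕ) : IsIntegrallyClosed (MvPolynomial (Fin n) R) := by
  induction n with
  | zero => exact .of_equiv (MvPolynomial.isEmptyAlgEquiv R (Fin 0)).symm.toRingEquiv
  | succ n ih => exact .of_equiv (MvPolynomial.finSuccEquiv R n).symm.toRingEquiv

open Polynomial in
theorem exists_finite_extension_forall_exists_pow_eq (K : Type u) [Field K] (C : Finset K) (n : ℕ)
    (hn : n ≠ 0) : ∃ (L : Type u) (_ : Field L) (_ : Algebra K L), FiniteDimensional K L ∧
      ∀ c ∈ C, ∃ x : L, x ^ n = algebraMap K L c := by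
  let f : K[X] := ∏ c ∈ C, (X ^ n - Polynomial.C c)
  refine ⟨f.SplittingField, inferInstance, inferInstance, inferInstance, fun c hc ↦ ?_⟩
  have hf : f ≠ 0 := Finset.prod_ne_zero_iff.mpr fun c _ ↦ X_pow_sub_C_ne_zero hn.bot_lt c
  have hs : ((X ^ n - Polynomial.C c).map (algebraMap K f.SplittingField)).Splits :=
    (SplittingField.splits f).of_dvd (by simpa using hf)
      (Polynomial.map_dvd _ (Finset.dvd_prod_of_mem _ hc))
  obtain ⟨x, hx⟩ := hs.exists_eval_eq_zero (by
    rw [degree_map, degree_X_pow_sub_C hn.bot_lt]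
    exact_mod_cast hn)
  exact ⟨x, by simpa [sub_eq_zero] using hx⟩

/-- The substitution `X i ↦ X i ^ k` on top of an integral extension of finite type of the
coefficients is finite. -/
theorem MvPolynomial.finite_expand_comp_map {A B σ : Type*} [Finite σ] [CommRing A] [CommRing B]
    [Algebra A B] [Module.Finite A B] {k : ℕ} (hk : k ≠ 0) :
    ((MvPolynomial.expand (σ := σ) k).toRingHom.comp
      (MvPolynomial.map (algebraMap A B))).Finite := by
  set f := (MvPolynomial.expand (σ := σ) k).toRingHom.comp (MvPolynomial.map (algebraMap A B))
  have hC (a : A) : f (C a) = C (algebraMap A B a) := by simp [f]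
  have hfC : f.comp C = (C (σ := σ)).comp (algebraMap A B) := RingHom.ext hC
  refine RingHom.IsIntegral.to_finite ?_ ?_
  · intro p
    induction p using MvPolynomial.induction_on with
    | C b =>
      have hb : (algebraMap A B).IsIntegralElem b := Algebra.IsIntegral.isIntegral b
      obtain ⟨P, hP, hPb⟩ := hb
      refine ⟨P.map C, hP.map _, ?_⟩
      rw [Polynomial.eval₂_map, hfC, ← Polynomial.hom_eval₂, hPb, map_zero]
    | add p q hp hq => exact hp.add f hq
    | mul_X p i hp =>
      refine hp.mul f ?_
      algebraize [f]
      refine IsIntegral.of_pow (R := MvPolynomial σ A) (n := k) hk.bot_lt ?_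
      have : (X i : MvPolynomial σ B) ^ k = f (X i) := by simp [f]
      rw [this]
      exact f.isIntegralElem_map
  · refine RingHom.FiniteType.of_comp_finiteType (f := C) ?_
    rw [hfC]
    have h1 : (C (σ := σ) (R := B)).FiniteType := by
      have : Algebra.FiniteType B (MvPolynomial σ B) := inferInstance
      rwa [← RingHom.finiteType_algebraMap] at this
    exact h1.comp (RingHom.finiteType_algebraMap.mpr inferInstance)

/-- Over a Japanese domain, finitely many polynomials acquire `q ^ n`-th roots in a finite
extension which is again an integrally closed Noetherian domain. -/
theorem MvPolynomial.exists_finite_extension_forall_exists_pow_eq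
    (A : Type u) [CommRing A] [IsDomain A] [IsNoetherianRing A]
    (K : Type u) [Field K] [Algebra A K] [IsFractionRing A K]
    (hJap : ∀ (L : Type u) [Field L] [Algebra K L] [FiniteDimensional K L]
        [Algebra A L] [IsScalarTower A K L], Module.Finite A (integralClosure A L))
    (q : ℕ) [ExpChar K q] (d n : ℕ) (D : Finset (MvPolynomial (Fin d) A)) :
    ∃ (T : Type u) (_ : CommRing T) (_ : Algebra (MvPolynomial (Fin d) A) T),
      IsDomain T ∧ IsNoetherianRing T ∧ IsIntegrallyClosed T ∧
      Module.Finite (MvPolynomial (Fin d) A) T ∧ FaithfulSMul (MvPolynomial (Fin d) A) T ∧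
      ∀ p ∈ D, ∃ t : T, t ^ q ^ n = algebraMap (MvPolynomial (Fin d) A) T p := by
  classical
  have hq : q ^ n ≠ 0 := (expChar_pow_pos K q n).ne'
  obtain ⟨L, _, _, _, hL⟩ := _root_.exists_finite_extension_forall_exists_pow_eq K
    (D.biUnion fun p ↦ p.support.image fun i ↦ algebraMap A K (p.coeff i)) (q ^ n) hq
  let : Algebra A L := ((algebraMap K L).comp (algebraMap A K)).toAlgebra
  have : IsScalarTower A K L := .of_algebraMap_eq' rfl
  let B := integralClosure A L
  have : Module.Finite A B := hJap L
  have : IsNoetherianRing B := IsNoetherianRing.of_finite A B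
  have : IsIntegrallyClosed B := integralClosure.isIntegrallyClosedOfFiniteExtension K
  have hAL : Function.Injective (algebraMap A L) :=
    (algebraMap K L).injective.comp (IsFractionRing.injective A K)
  have hAB : Function.Injective (algebraMap A B) :=
    Function.Injective.of_comp (f := algebraMap B L) hAL
  have : ExpChar L q := expChar_of_injective_algebraMap (algebraMap K L).injective q
  have : ExpChar B q := ((algebraMap B L).expChar_iff Subtype.val_injective q).mpr ‹_›
  have : ExpChar (MvPolynomial (Fin d) B) q :=
    expChar_of_injective_ringHom (MvPolynomial.C_injective (Fin d) B) q
  let f : MvPolynomial (Fin d) A →+* MvPolynomial (Fin d) B :=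
    (expand (q ^ n)).toRingHom.comp (map (algebraMap A B))
  refine ⟨MvPolynomial (Fin d) B, inferInstance, f.toAlgebra, inferInstance, inferInstance,
    inferInstance, finite_expand_comp_map hq, ?_, fun p hp ↦ ?_⟩
  · let := f.toAlgebra
    rw [faithfulSMul_iff_algebraMap_injective]
    exact (expand_injective hq.bot_lt).comp (map_injective _ hAB)
  · change f p ∈ (iterateFrobenius (MvPolynomial (Fin d) B) q n).range
    rw [p.as_sum, map_sum]
    refine sum_mem fun i hi ↦ ?_
    obtain ⟨x, hx⟩ := hL (algebraMap A K (p.coeff i))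
      (Finset.mem_biUnion.mpr ⟨p, hp, Finset.mem_image_of_mem _ hi⟩)
    have hxB : IsIntegral A x := by
      refine IsIntegral.of_pow hq.bot_lt ?_
      rw [hx, ← IsScalarTower.algebraMap_apply]
      exact isIntegral_algebraMap
    refine ⟨monomial i ⟨x, hxB⟩, ?_⟩
    have : (⟨x, hxB⟩ : B) ^ q ^ n = algebraMap A B (p.coeff i) := Subtype.ext hx
    simp [f, iterateFrobenius_def, monomial_pow, this]

/-- A polynomial ring over a Japanese Noetherian domain is Japanese. -/
theorem MvPolynomial.finite_integralClosure
    (A : Type u) [CommRing A] [IsDomain A] [IsNoetherianRing A]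
    (K : Type u) [Field K] [Algebra A K] [IsFractionRing A K]
    (hJap : ∀ (L : Type u) [Field L] [Algebra K L] [FiniteDimensional K L]
        [Algebra A L] [IsScalarTower A K L], Module.Finite A (integralClosure A L))
    (d : ℕ) (F M : Type u) [Field F] [Field M] [Algebra (MvPolynomial (Fin d) A) F]
    [IsFractionRing (MvPolynomial (Fin d) A) F] [Algebra F M] [FiniteDimensional F M]
    [Algebra (MvPolynomial (Fin d) A) M] [IsScalarTower (MvPolynomial (Fin d) A) F M] :
    Module.Finite (MvPolynomial (Fin d) A) (integralClosure (MvPolynomial (Fin d) A) M) := by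
  classical
  let S := MvPolynomial (Fin d) A
  obtain ⟨q, _⟩ := ExpChar.exists K
  have : ExpChar A q :=
    ((algebraMap A K).expChar_iff (IsFractionRing.injective A K) q).mpr ‹_›
  have : ExpChar S q := expChar_of_injective_ringHom (MvPolynomial.C_injective (Fin d) A) q
  have : ExpChar F q := expChar_of_injective_algebraMap (IsFractionRing.injective S F) q
  obtain ⟨C, n, hC⟩ := exists_finite_separable_extension_of_forall_exists_pow_eq F M q
  choose num den hden hfrac using fun c : F ↦ IsFractionRing.div_surjective (A := S) c
  obtain ⟨T, _, _, _, _, _, _, _, hT⟩ := exists_finite_extension_forall_exists_pow_eq A K hJap q d n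
    (C.image num ∪ C.image den)
  let E := FractionRing T
  have hSE : Function.Injective (algebraMap S E) := by
    rw [IsScalarTower.algebraMap_eq S T E]
    exact (IsFractionRing.injective T E).comp (FaithfulSMul.algebraMap_injective S T)
  let : Algebra F E := (IsFractionRing.lift hSE).toAlgebra
  have : IsScalarTower S F E := .of_algebraMap_eq fun s ↦ (IsFractionRing.lift_algebraMap hSE s).symm
  obtain ⟨N, _, _, ⟨φ⟩⟩ := hC E fun c hc ↦ by
    obtain ⟨t, ht⟩ := hT (num c) (by simp; grind)
    obtain ⟨u, hu⟩ := hT (den c) (by simp; grind)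
    refine ⟨algebraMap T E t / algebraMap T E u, ?_⟩
    rw [← hfrac c, map_div₀, div_pow, ← map_pow, ← map_pow, ht, hu,
      ← IsScalarTower.algebraMap_apply, ← IsScalarTower.algebraMap_apply,
      ← IsScalarTower.algebraMap_apply, ← IsScalarTower.algebraMap_apply]
  let : Algebra S N := ((algebraMap E N).comp (algebraMap S E)).toAlgebra
  have : IsScalarTower S E N := .of_algebraMap_eq' rfl
  have : IsScalarTower S T N := .of_algebraMap_eq' rfl
  have : IsScalarTower S F N := .of_algebraMap_eq fun s ↦ by
    rw [IsScalarTower.algebraMap_apply S E N, IsScalarTower.algebraMap_apply S F E,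
      ← IsScalarTower.algebraMap_apply F E N]
  have : Module.Finite T (integralClosure T N) := IsIntegralClosure.finite T E N _
  have : Module.Finite S (integralClosure T N) := .trans T _
  have : IsNoetherian S (integralClosure T N) := isNoetherian_of_isNoetherianRing_of_finite _ _
  let ψ : M →ₐ[S] N := φ.restrictScalars S
  let ψ' : integralClosure S M →ₗ[S] integralClosure T N :=
    { toFun x := ⟨ψ x, (x.2.map ψ).tower_top⟩
      map_add' _ _ := Subtype.ext (map_add ψ _ _)
      map_smul' _ _ := Subtype.ext (map_smul ψ _ _) }
  exact Module.Finite.of_injective ψ' fun x y h ↦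
    Subtype.ext (φ.injective (congrArg Subtype.val h))

section

open scoped TensorProduct

theorem IsDedekindDomain.exists_notMem_dvd_mul_or_dvd_mul {A : Type*} [CommRing A]
    [IsDedekindDomain A] (p : Ideal A) [p.IsPrime] (a b : A) :
    ∃ s ∉ p, a ∣ s * b ∨ b ∣ s * a := by
  obtain rfl | hp := eq_or_ne p ⊥
  · by_cases ha : a = 0
    · exact ⟨1, by simp, .inr (by simp [ha])⟩
    · exact ⟨a, by simpa using ha, .inl (dvd_mul_right a b)⟩
  · let V := Localization.AtPrime p
    have : IsDiscreteValuationRing V :=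
      IsLocalization.AtPrime.isDiscreteValuationRing_of_dedekind_domain A hp V
    have key (a b : A) (h : algebraMap A V a ∣ algebraMap A V b) : ∃ s ∉ p, a ∣ s * b := by
      obtain ⟨v, hv⟩ := h
      obtain ⟨⟨c, s⟩, hc⟩ := IsLocalization.surj p.primeCompl v
      refine ⟨s, s.2, c, IsLocalization.injective V p.primeCompl_le_nonZeroDivisors ?_⟩
      rw [map_mul, map_mul, hv, ← hc]
      ring
    obtain h | h := ValuationRing.dvd_total (algebraMap A V a) (algebraMap A V b)
    · obtain ⟨s, hs, h⟩ := key a b h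
      exact ⟨s, hs, .inl h⟩
    · obtain ⟨s, hs, h⟩ := key b a h
      exact ⟨s, hs, .inr h⟩

theorem IsDedekindDomain.exists_mem_exists_notMem_forall_dvd_mul {A ι : Type*} [CommRing A]
    [IsDedekindDomain A] (p : Ideal A) [p.IsPrime] (c : ι → A) {t : Finset ι}
    (ht : t.Nonempty) : ∃ j ∈ t, ∃ s ∉ p, ∀ i ∈ t, c j ∣ s * c i := by
  induction ht using Finset.Nonempty.cons_induction with
  | singleton j => exact ⟨j, by simp, 1, p.one_notMem, by simp⟩
  | cons k t hk ht ih =>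
    obtain ⟨j, hj, s, hs, h⟩ := ih
    obtain ⟨u, hu, hjk | hkj⟩ := exists_notMem_dvd_mul_or_dvd_mul p (c j) (c k)
    · refine ⟨j, by simp [hj], s * u, ‹p.IsPrime›.mul_notMem hs hu, fun i hi ↦ ?_⟩
      obtain rfl | hi := Finset.mem_cons.mp hi
      · rw [mul_assoc]
        exact hjk.mul_left s
      · rw [mul_right_comm]
        exact (h i hi).mul_right u
    · refine ⟨k, by simp, s * u, ‹p.IsPrime›.mul_notMem hs hu, fun i hi ↦ ?_⟩
      obtain rfl | hi := Finset.mem_cons.mp hi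
      · exact dvd_mul_left _ _
      · refine hkj.trans ?_
        rw [mul_comm s u, mul_assoc]
        exact mul_dvd_mul_left u (h i hi)

/-- Elements of a torsion-free algebra over a Dedekind domain which are algebraically independent
in some fibre are algebraically independent. -/
theorem IsDedekindDomain.algebraicIndependent_of_fiber {A R σ : Type*} [CommRing A]
    [IsDedekindDomain A] [CommRing R] [IsDomain R] [Algebra A R] [FaithfulSMul A R]
    (p : Ideal A) [p.IsPrime] {y : σ → R}
    (hy : AlgebraicIndependent p.ResidueField fun i ↦ (1 ⊗ₜ[A] y i : p.Fiber R)) :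
    AlgebraicIndependent A y := by
  rw [algebraicIndependent_iff]
  intro F hF
  by_contra hF0
  obtain ⟨j, hj, s, hs, h⟩ := exists_mem_exists_notMem_forall_dvd_mul p
    (fun i ↦ F.coeff i) (MvPolynomial.support_nonempty.mpr hF0)
  have hdvd : MvPolynomial.C (F.coeff j) ∣ MvPolynomial.C s * F := by
    rw [MvPolynomial.C_dvd_iff_dvd_coeff]
    intro i
    rw [MvPolynomial.coeff_C_mul]
    by_cases hi : i ∈ F.support
    · exact h i hi
    · simp [MvPolynomial.notMem_support_iff.mp hi]
  obtain ⟨G, hG⟩ := hdvd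
  have hj0 : F.coeff j ≠ 0 := MvPolynomial.mem_support_iff.mp hj
  have hGj : G.coeff j = s := by
    have := congrArg (MvPolynomial.coeff j) hG
    rw [MvPolynomial.coeff_C_mul, MvPolynomial.coeff_C_mul, mul_comm] at this
    exact (mul_left_cancel₀ hj0 this).symm
  have hyG : MvPolynomial.aeval y G = 0 := by
    have := congrArg (MvPolynomial.aeval y) hG
    rw [map_mul, map_mul, hF, mul_zero, MvPolynomial.aeval_C] at this
    exact (mul_eq_zero.mp this.symm).resolve_left
      ((map_ne_zero_iff _ (FaithfulSMul.algebraMap_injective A R)).mpr hj0)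
  have hfib : MvPolynomial.aeval (fun i ↦ (1 ⊗ₜ[A] y i : p.Fiber R))
      (MvPolynomial.map (algebraMap A p.ResidueField) G) = 0 := by
    rw [MvPolynomial.aeval_map_algebraMap]
    exact (MvPolynomial.comp_aeval_apply y
      (Algebra.TensorProduct.includeRight : R →ₐ[A] p.Fiber R) G).symm.trans (by rw [hyG, map_zero])
  have hG0 := (algebraicIndependent_iff.mp hy) _ hfib
  have := congrArg (MvPolynomial.coeff j) hG0
  rw [MvPolynomial.coeff_map, hGj, MvPolynomial.coeff_zero] at this
  exact hs (by simpa using this)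

/-- Noether normalization of a fibre, with the variables coming from the total space. -/
theorem Ideal.Fiber.exists_algebraicIndependent_finite_aeval {A R : Type*} [CommRing A]
    [CommRing R] [Algebra A R] [Algebra.FiniteType A R] (p : Ideal A) [p.IsPrime]
    [Nontrivial (p.Fiber R)] :
    ∃ (n : ℕ) (y : Fin n → R),
      AlgebraicIndependent p.ResidueField (fun i ↦ (1 ⊗ₜ[A] y i : p.Fiber R)) ∧
      (MvPolynomial.aeval (R := p.ResidueField)
        fun i ↦ (1 ⊗ₜ[A] y i : p.Fiber R)).toRingHom.Finite := by
  obtain ⟨n, g, hg, hgf⟩ := exists_finite_inj_algHom_of_fg p.ResidueField (p.Fiber R)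
  choose s hs y hy using fun i ↦ Ideal.Fiber.exists_smul_eq_one_tmul p (g (MvPolynomial.X i))
  let k := p.ResidueField
  obtain ⟨a, ha, hya⟩ : ∃ a : Fin n → k, (∀ i, a i ≠ 0) ∧
      ∀ i, a i • g (MvPolynomial.X i) = 1 ⊗ₜ[A] y i :=
    ⟨fun i ↦ algebraMap A k (s i), fun i ↦ by simpa [k] using hs i,
      fun i ↦ by rw [algebraMap_smul, hy]⟩
  let e₁ : MvPolynomial (Fin n) k →ₐ[k] MvPolynomial (Fin n) k :=
    MvPolynomial.aeval fun i ↦ a i • MvPolynomial.X i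
  let e₂ : MvPolynomial (Fin n) k →ₐ[k] MvPolynomial (Fin n) k :=
    MvPolynomial.aeval fun i ↦ (a i)⁻¹ • MvPolynomial.X i
  have h₁ : e₁.comp e₂ = AlgHom.id k _ := by
    ext i : 1
    simp only [e₁, e₂, AlgHom.comp_apply, MvPolynomial.aeval_X, map_smul, smul_smul,
      inv_mul_cancel₀ (ha i), one_smul, AlgHom.id_apply]
  have h₂ : e₂.comp e₁ = AlgHom.id k _ := by
    ext i : 1
    simp only [e₁, e₂, AlgHom.comp_apply, MvPolynomial.aeval_X, map_smul, smul_smul,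
      mul_inv_cancel₀ (ha i), one_smul, AlgHom.id_apply]
  have hge : MvPolynomial.aeval (R := k) (fun i ↦ (1 ⊗ₜ[A] y i : p.Fiber R)) = g.comp e₁ := by
    ext i : 1
    simp only [e₁, AlgHom.comp_apply, MvPolynomial.aeval_X, map_smul, hya]
  have hbij : Function.Bijective e₁ :=
    (AlgEquiv.ofAlgHom e₁ e₂ h₁ h₂).bijective
  refine ⟨n, y, ?_, ?_⟩
  · rw [algebraicIndependent_iff_injective_aeval, hge]
    exact hg.comp hbij.1
  · rw [hge]
    exact RingHom.Finite.comp hgf (.of_surjective _ hbij.2)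

/-- Every polynomial over `κ(p)` is, up to a nonzero constant, the image of a polynomial over the
base ring, so the map of polynomial rings is quasi-finite. -/
theorem MvPolynomial.exists_notMem_C_mul_mem_range_map {A σ : Type*} [CommRing A] (p : Ideal A)
    [p.IsPrime] (F : MvPolynomial σ p.ResidueField) :
    ∃ s ∉ p, F * C (algebraMap A p.ResidueField s) ∈
      (map (σ := σ) (algebraMap A p.ResidueField)).range := by
  induction F using MvPolynomial.induction_on with
  | C c =>
    obtain ⟨a, b, hb, rfl⟩ := IsFractionRing.div_surjective (A := A ⧸ p) c
    obtain ⟨a, rfl⟩ := Ideal.Quotient.mk_surjective a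
    obtain ⟨b, rfl⟩ := Ideal.Quotient.mk_surjective b
    have hb' : b ∉ p := by
      simpa [Ideal.Quotient.eq_zero_iff_mem] using nonZeroDivisors.ne_zero hb
    have hbk : algebraMap A p.ResidueField b ≠ 0 := by simpa using hb'
    refine ⟨b, hb', C a, ?_⟩
    rw [map_C, ← map_mul]
    congr 1
    exact (div_mul_cancel₀ _ hbk).symm
  | add F G hF hG =>
    obtain ⟨s, hs, hF⟩ := hF
    obtain ⟨t, ht, hG⟩ := hG
    refine ⟨s * t, ‹p.IsPrime›.mul_notMem hs ht, ?_⟩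
    have hC (u : A) : C (algebraMap A p.ResidueField u) ∈
        (map (σ := σ) (algebraMap A p.ResidueField)).range := ⟨C u, map_C _ _⟩
    have := add_mem (mul_mem hF (hC t)) (mul_mem hG (hC s))
    convert this using 1
    simp only [map_mul]
    ring
  | mul_X F i hF =>
    obtain ⟨s, hs, hF⟩ := hF
    refine ⟨s, hs, ?_⟩
    rw [mul_right_comm]
    exact mul_mem hF ⟨X i, map_X _ _⟩

/-- Quasi-finiteness at a prime follows from finiteness of the fibre as a set. -/
theorem Algebra.QuasiFiniteAt.of_finite_comap_preimage_singleton {S R : Type*} [CommRing S]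
    [CommRing R] [Algebra S R] [Algebra.FiniteType S R] (P : PrimeSpectrum R)
    (h : (PrimeSpectrum.comap (algebraMap S R) ⁻¹'
      {P.comap (algebraMap S R)}).Finite) : Algebra.QuasiFiniteAt S P.asIdeal := by
  let q := P.comap (algebraMap S R)
  have : Finite (PrimeSpectrum (q.asIdeal.Fiber R)) :=
    (PrimeSpectrum.preimageEquivFiber S R q).finite_iff.mp h.to_subtype
  have : IsJacobsonRing (q.asIdeal.Fiber R) :=
    isJacobsonRing_of_finiteType (A := q.asIdeal.ResidueField)
  refine .of_isOpen_singleton_fiber P ?_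
  have : DiscreteTopology (PrimeSpectrum (q.asIdeal.Fiber R)) := inferInstance
  have := (PrimeSpectrum.preimageHomeomorphFiber S R q).symm.discreteTopology
  exact isOpen_discrete _

theorem exists_algebraicIndependent_isIntegralElem_pow_mul {A R : Type*} [CommRing A]
    [IsDedekindDomain A] [CommRing R] [IsDomain R] [Algebra A R] [FaithfulSMul A R]
    [Algebra.FiniteType A R] (P : Ideal R) [P.IsPrime] :
    ∃ (n : ℕ) (y : Fin n → R), AlgebraicIndependent A y ∧
      ∃ r ∉ P, ∀ x : R, ∃ m : ℕ,
        (MvPolynomial.aeval (R := A) y).toRingHom.IsIntegralElem (r ^ m * x) := by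
  let p := P.under A
  let Pp : PrimeSpectrum R := ⟨P, ‹_›⟩
  let k := p.ResidueField
  let T := p.Fiber R
  have : Nontrivial T := by
    have := (PrimeSpectrum.preimageEquivFiber A R (Pp.comap (algebraMap A R)) ⟨Pp, rfl⟩).2
    exact nontrivial_of_ne 0 1 fun h ↦ this.ne_top ((Ideal.eq_top_iff_one _).mpr (h ▸ zero_mem _))
  obtain ⟨n, y, hy, hyf⟩ := Ideal.Fiber.exists_algebraicIndependent_finite_aeval (R := R) p
  refine ⟨n, y, IsDedekindDomain.algebraicIndependent_of_fiber p hy, ?_⟩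
  let φ : MvPolynomial (Fin n) A →ₐ[A] R := MvPolynomial.aeval y
  let ψ : MvPolynomial (Fin n) k →ₐ[k] T := MvPolynomial.aeval fun i ↦ 1 ⊗ₜ[A] y i
  let ι : R →ₐ[A] T := Algebra.TensorProduct.includeRight
  let κ : MvPolynomial (Fin n) A →+* MvPolynomial (Fin n) k :=
    MvPolynomial.map (algebraMap A k)
  have hcomm : ψ.toRingHom.comp κ = ι.toRingHom.comp φ.toRingHom := by
    ext i
    · simp [ψ, κ, ι, φ]
      rfl
    · simp [ψ, κ, ι, φ]
      rfl
  let := φ.toRingHom.toAlgebra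
  let := κ.toAlgebra
  let := ψ.toRingHom.toAlgebra
  let := (ψ.toRingHom.comp κ).toAlgebra
  have : IsScalarTower (MvPolynomial (Fin n) A) (MvPolynomial (Fin n) k) T := .of_algebraMap_eq' rfl
  have : IsScalarTower A (MvPolynomial (Fin n) A) R := .of_algebraMap_eq' φ.comp_algebraMap.symm
  have : Algebra.FiniteType (MvPolynomial (Fin n) A) R := .of_restrictScalars_finiteType A _ _
  have : Module.Finite (MvPolynomial (Fin n) k) T := hyf
  have : Algebra.QuasiFinite (MvPolynomial (Fin n) A) (MvPolynomial (Fin n) k) := by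
    refine .of_forall_exists_mul_mem_range (Algebra.ofId (MvPolynomial (Fin n) A) _) fun F ↦ ?_
    obtain ⟨s, hs, G, hG⟩ := MvPolynomial.exists_notMem_C_mul_mem_range_map p F
    have hκ : algebraMap (MvPolynomial (Fin n) A) (MvPolynomial (Fin n) k) (MvPolynomial.C s) =
      MvPolynomial.C (algebraMap A k s) := MvPolynomial.map_C _ _
    have hsk : algebraMap A k s ≠ 0 := by simpa [k] using hs
    refine ⟨MvPolynomial.C s, ?_, G, ?_⟩
    · rw [Algebra.ofId_apply, hκ]
      exact hsk.isUnit.map MvPolynomial.C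
    · rw [Algebra.ofId_apply, hκ]
      exact hG
  have : Algebra.QuasiFinite (MvPolynomial (Fin n) A) T :=
    .trans _ (MvPolynomial (Fin n) k) _
  have hfin : (PrimeSpectrum.comap (algebraMap (MvPolynomial (Fin n) A) R) ⁻¹'
      {Pp.comap (algebraMap (MvPolynomial (Fin n) A) R)}).Finite := by
    refine ((Algebra.QuasiFinite.finite_comap_preimage_singleton (S := T)
      (Pp.comap (algebraMap (MvPolynomial (Fin n) A) R))).image
        (PrimeSpectrum.comap ι.toRingHom)).subset fun Q hQ ↦ ?_
    have hQp : Q.comap (algebraMap A R) = Pp.comap (algebraMap A R) := by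
      have := congrArg (PrimeSpectrum.comap (algebraMap A (MvPolynomial (Fin n) A))) hQ
      rwa [← PrimeSpectrum.comap_comp_apply, ← PrimeSpectrum.comap_comp_apply,
        ← IsScalarTower.algebraMap_eq] at this
    let e := PrimeSpectrum.preimageEquivFiber A R (Pp.comap (algebraMap A R))
    have hQe : PrimeSpectrum.comap ι.toRingHom (e ⟨Q, hQp⟩) = Q :=
      congrArg Subtype.val (e.symm_apply_apply ⟨Q, hQp⟩)
    refine ⟨e ⟨Q, hQp⟩, ?_, hQe⟩
    exact (congrArg (PrimeSpectrum.comap · (e ⟨Q, hQp⟩)) hcomm).trans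
      ((congrArg (PrimeSpectrum.comap φ.toRingHom) hQe).trans hQ)
  have : Algebra.QuasiFiniteAt (MvPolynomial (Fin n) A) P :=
    Algebra.QuasiFiniteAt.of_finite_comap_preimage_singleton Pp hfin
  exact Algebra.zariskisMainProperty_iff'.mp (.of_finiteType P)

end

open Polynomial in
/-- If every element of `R` becomes integral over `S` after multiplication by a power of `r`, then
so does every element integral over `R`. -/
theorem IsIntegral.exists_isIntegral_pow_smul {S R M : Type*} [CommRing S] [CommRing R]
    [CommRing M] [Algebra S R] [Algebra R M] [Algebra S M] [IsScalarTower S R M] {r : R}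
    (hr : ∀ x : R, ∃ m : ℕ, IsIntegral S (r ^ m * x)) {x : M} (hx : IsIntegral R x) :
    ∃ m : ℕ, IsIntegral S (r ^ m • x) := by
  have hrS : IsIntegral S r := by
    obtain ⟨m, hm⟩ := hr r
    exact .of_pow m.succ_pos (by rwa [pow_succ])
  obtain ⟨f, hf, hfx⟩ := hx
  choose m hm using fun i ↦ hr (f.coeff i)
  let N := (Finset.range f.natDegree).sup m
  have hcoeff (i : ℕ) : IsIntegral S ((f.scaleRoots (r ^ N)).coeff i) := by
    rw [coeff_scaleRoots]
    obtain hi | rfl | hi := lt_trichotomy i f.natDegree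
    · have hiN : m i ≤ N := Finset.le_sup (Finset.mem_range.mpr hi)
      obtain ⟨k, hk⟩ := Nat.exists_eq_add_of_le hiN
      obtain ⟨j, hj⟩ := Nat.exists_eq_add_of_lt hi
      have : f.coeff i * (r ^ N) ^ (f.natDegree - i) =
          r ^ m i * f.coeff i * (r ^ k * (r ^ N) ^ j) := by
        rw [show f.natDegree - i = j + 1 by omega, pow_succ, hk]
        ring
      rw [this]
      exact (hm i).mul ((hrS.pow k).mul ((hrS.pow N).pow j))
    · rw [hf.coeff_natDegree, one_mul]
      exact (hrS.pow N).pow _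
    · rw [coeff_eq_zero_of_natDegree_lt hi, zero_mul]
      exact isIntegral_zero
  refine ⟨N, ?_⟩
  have hlift : f.scaleRoots (r ^ N) ∈ lifts (algebraMap (integralClosure S R) R) :=
    (lifts_iff_coeff_lifts _).mpr fun i ↦ ⟨⟨_, hcoeff i⟩, rfl⟩
  obtain ⟨g, hg, -, hgm⟩ := lifts_and_natDegree_eq_and_monic hlift
    ((monic_scaleRoots_iff _).mpr hf)
  have hgx : IsIntegral (integralClosure S R) (r ^ N • x) := by
    refine ⟨g, hgm, ?_⟩
    rw [← aeval_def, ← aeval_map_algebraMap R, hg, Algebra.smul_def]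
    exact scaleRoots_aeval_eq_zero hfx
  exact isIntegral_trans _ hgx

/-- Local form of the finiteness of integral closures over finitely generated extensions of a
Japanese Dedekind domain. -/
theorem exists_notMem_exists_fg_le_integralClosure
    (A : Type u) [CommRing A] [IsDedekindDomain A]
    (K : Type u) [Field K] [Algebra A K] [IsFractionRing A K]
    (hJap : ∀ (L : Type u) [Field L] [Algebra K L] [FiniteDimensional K L]
        [Algebra A L] [IsScalarTower A K L], Module.Finite A (integralClosure A L))
    (R : Type u) [CommRing R] [IsDomain R] [Algebra A R] [Algebra.FiniteType A R]
    [FaithfulSMul A R] (F M : Type u) [Field F] [Algebra R F] [IsFractionRing R F]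
    [Field M] [Algebra F M] [FiniteDimensional F M] [Algebra R M] [IsScalarTower R F M]
    (P : Ideal R) [P.IsPrime] :
    ∃ r ∉ P, ∃ N : Submodule R M, N.FG ∧ N ≤ (integralClosure R M).toSubmodule ∧
      ∀ x ∈ integralClosure R M, ∃ m : ℕ, r ^ m • x ∈ N := by
  obtain ⟨n, y, hy, r, hrP, hr⟩ :=
    exists_algebraicIndependent_isIntegralElem_pow_mul (A := A) P
  let S := MvPolynomial (Fin n) A
  let : Algebra S R := (MvPolynomial.aeval y).toRingHom.toAlgebra
  have hr (x : R) : ∃ m : ℕ, IsIntegral S (r ^ m * x) := hr x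
  have : IsScalarTower A S R :=
    .of_algebraMap_eq' (MvPolynomial.aeval (R := A) y).comp_algebraMap.symm
  have : Algebra.FiniteType S R := .of_restrictScalars_finiteType A _ _
  have : FaithfulSMul S R := (faithfulSMul_iff_algebraMap_injective _ _).mpr hy
  let : Algebra S F := ((algebraMap R F).comp (algebraMap S R)).toAlgebra
  have : IsScalarTower S R F := .of_algebraMap_eq' rfl
  let : Algebra S M := ((algebraMap R M).comp (algebraMap S R)).toAlgebra
  have : IsScalarTower S R M := .of_algebraMap_eq' rfl
  have : IsScalarTower S F M := .of_algebraMap_eq fun s ↦ by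
    rw [IsScalarTower.algebraMap_apply S R M, IsScalarTower.algebraMap_apply S R F,
      ← IsScalarTower.algebraMap_apply R F M]
  have hSM : Function.Injective (algebraMap S M) := by
    rw [IsScalarTower.algebraMap_eq S F M, IsScalarTower.algebraMap_eq S R F]
    exact (algebraMap F M).injective.comp
      ((IsFractionRing.injective R F).comp (FaithfulSMul.algebraMap_injective S R))
  let : Algebra (FractionRing S) M := (IsFractionRing.lift hSM).toAlgebra
  have : IsScalarTower S (FractionRing S) M :=
    .of_algebraMap_eq fun s ↦ (IsFractionRing.lift_algebraMap hSM s).symm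
  have hrS : IsAlgebraic S r := by
    obtain ⟨m, hm⟩ := hr r
    exact (IsIntegral.of_pow m.succ_pos (by rwa [pow_succ])).isAlgebraic
  have hr0 : r ≠ 0 := fun h ↦ hrP (h ▸ P.zero_mem)
  have : Algebra.IsAlgebraic S R := ⟨fun x ↦ by
    obtain ⟨m, hm⟩ := hr x
    exact .of_mul (mem_nonZeroDivisors_of_ne_zero (pow_ne_zero m hr0)) (hrS.pow m) hm.isAlgebraic⟩
  have : Algebra.IsAlgebraic R F := IsLocalization.isAlgebraic F (nonZeroDivisors R)
  have : Algebra.IsAlgebraic S F := .trans S R F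
  have : Algebra.IsAlgebraic S M := .trans S F M
  have : Algebra.IsAlgebraic (FractionRing S) M := IsFractionRing.comap_isAlgebraic_iff.mp this
  have : Algebra.EssFiniteType R F := .of_isLocalization F (nonZeroDivisors R)
  have : Algebra.EssFiniteType S F := .comp S R F
  have : Algebra.EssFiniteType S M := .comp S F M
  have : Algebra.EssFiniteType (FractionRing S) M := .of_comp S _ _
  have : FiniteDimensional (FractionRing S) M := Algebra.finite_of_essFiniteType_of_isAlgebraic
  have hfin : Module.Finite S (integralClosure S M) :=
    MvPolynomial.finite_integralClosure A K hJap n (FractionRing S) M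
  obtain ⟨t, ht⟩ : (integralClosure S M).toSubmodule.FG := Module.Finite.iff_fg.mp hfin
  have htS : ∀ x ∈ integralClosure S M, x ∈ Submodule.span R (t : Set M) := fun x hx ↦
    Submodule.span_le_restrictScalars S R _ (ht.ge hx)
  refine ⟨r, hrP, Submodule.span R t, ⟨t, rfl⟩, Submodule.span_le.mpr fun x hx ↦ ?_,
    fun x hx ↦ ?_⟩
  · have : x ∈ (integralClosure S M).toSubmodule := ht.le (Submodule.subset_span hx)
    exact IsIntegral.tower_top this
  · obtain ⟨m, hm⟩ := IsIntegral.exists_isIntegral_pow_smul hr hx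
    exact ⟨m, htS _ hm⟩

/-- A Japanese Dedekind domain has finite integral closures in finite extensions of fraction
fields of its torsion-free algebras of finite type. -/
theorem finite_integralClosure_of_faithfulSMul
    (A : Type u) [CommRing A] [IsDedekindDomain A]
    (K : Type u) [Field K] [Algebra A K] [IsFractionRing A K]
    (hJap : ∀ (L : Type u) [Field L] [Algebra K L] [FiniteDimensional K L]
        [Algebra A L] [IsScalarTower A K L], Module.Finite A (integralClosure A L))
    (R : Type u) [CommRing R] [IsDomain R] [Algebra A R] [Algebra.FiniteType A R]
    [FaithfulSMul A R] (F M : Type u) [Field F] [Algebra R F] [IsFractionRing R F]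
    [Field M] [Algebra F M] [FiniteDimensional F M] [Algebra R M] [IsScalarTower R F M] :
    Module.Finite R (integralClosure R M) := by
  choose r hr N hN hle hpow using fun P : PrimeSpectrum R ↦
    exists_notMem_exists_fg_le_integralClosure A K hJap R F M P.asIdeal
  have htop : Ideal.span (Set.range r) = ⊤ := by
    by_contra h
    obtain ⟨P, hP, hle⟩ := Ideal.exists_le_maximal _ h
    exact hr ⟨P, hP.isPrime⟩ (hle (Ideal.subset_span ⟨_, rfl⟩))
  obtain ⟨s, hs, hs1⟩ := (Ideal.span_eq_top_iff_finite _).mp htop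
  choose! P hP using fun a (ha : a ∈ s) ↦ hs ha
  refine Module.Finite.iff_fg (N := (integralClosure R M).toSubmodule) |>.mpr ?_
  have : (integralClosure R M).toSubmodule = s.sup fun a ↦ N (P a) := by
    refine le_antisymm (fun x hx ↦ ?_) (Finset.sup_le fun a _ ↦ hle _)
    refine Submodule.mem_of_span_eq_top_of_smul_pow_mem _ s hs1 x fun a ↦ ?_
    obtain ⟨m, hm⟩ := hpow (P a) x hx
    rw [hP a a.2] at hm
    exact ⟨m, Finset.le_sup (f := fun a ↦ N (P a)) a.2 hm⟩
  rw [this]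
  exact Submodule.fg_finset_sup _ _ fun a _ ↦ hN _

/-- A Japanese Dedekind domain is universally Japanese: if `A` is a
Dedekind domain with fraction field `K` such that for every finite field extension `L/K`
the integral closure of `A` in `L` is a finitely generated `A`-module, then every finitely
generated `A`-algebra `R` that is an integral domain is Japanese, i.e. for every finite
field extension `M` of the fraction field of `R`, the integral closure of `R` in `M` is a
finitely generated `R`-module. -/
theorem universally_japanese_of_japanese_dedekind
    (A : Type u) [CommRing A] [IsDedekindDomain A]
    (K : Type u) [Field K] [Algebra A K] [IsFractionRing A K]
    (hJap : ∀ (L : Type u) [Field L] [Algebra K L] [FiniteDimensional K L]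
        [Algebra A L] [IsScalarTower A K L],
        Module.Finite A (integralClosure A L)) :
    ∀ (R : Type u) [CommRing R] [IsDomain R] [Algebra A R] [Algebra.FiniteType A R]
      (M : Type u) [Field M] [Algebra (FractionRing R) M]
      [FiniteDimensional (FractionRing R) M]
      [Algebra R M] [IsScalarTower R (FractionRing R) M],
      Module.Finite R (integralClosure R M) := by
  intro R _ _ _ _ M _ _ _ _ _
  let p := RingHom.ker (algebraMap A R)
  have : p.IsPrime := RingHom.ker_isPrime _
  obtain hp | hp := eq_or_ne p ⊥
  · have : FaithfulSMul A R :=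
      (faithfulSMul_iff_algebraMap_injective _ _).mpr ((RingHom.injective_iff_ker_eq_bot _).mpr hp)
    exact finite_integralClosure_of_faithfulSMul A K hJap R (FractionRing R) M
  · have : p.IsMaximal := ‹p.IsPrime›.isMaximal hp
    let : Field (A ⧸ p) := Ideal.Quotient.field p
    let : Algebra (A ⧸ p) R := (RingHom.kerLift (algebraMap A R)).toAlgebra
    have : IsScalarTower A (A ⧸ p) R := .of_algebraMap_eq' rfl
    have : Algebra.FiniteType (A ⧸ p) R := .of_restrictScalars_finiteType A _ _
    have : Module.Finite (A ⧸ p) (FractionRing (A ⧸ p)) :=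
      .of_surjective (Algebra.linearMap _ _)
        (Field.localization_map_bijective (zero_notMem_nonZeroDivisors (M₀ := A ⧸ p))).2
    exact finite_integralClosure_of_faithfulSMul (A ⧸ p) (FractionRing (A ⧸ p))
      (fun L _ _ _ _ _ ↦ by
        have : Module.Finite (A ⧸ p) L := .trans (FractionRing (A ⧸ p)) L
        exact inferInstanceAs
          (Module.Finite (A ⧸ p) (integralClosure (A ⧸ p) L).toSubmodule)) R (FractionRing R) M
end

section
/- Let A be a Noetherian integral domain and X = Spec A. If there exists a nonzero element f ∈ A such that the localization A[1/f] is normal (i.e. integrally closed in the fraction field of A), then the normal locus Nor(X) = { 𝔭 ∈ Spec A : the localization A_𝔭 is integrally closed in the fraction field of A } is an open subset of Spec A. -/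
open nonZeroDivisors in
/-- A localization of a domain `A` is integrally closed iff every element of the fraction field
which is integral over `A` has a multiple in `A` by an element of the submonoid. -/
theorem IsLocalization.isIntegrallyClosed_iff_exists_smul_mem {A R : Type*} (K : Type*)
    [CommRing A] [IsDomain A] [CommRing R] [Algebra A R] [Field K] [Algebra A K]
    [IsFractionRing A K] (S : Submonoid A) (hS : S ≤ A⁰) [IsLocalization S R] :
    IsIntegrallyClosed R ↔
      ∀ x : K, IsIntegral A x → ∃ s ∈ S, ∃ a : A, algebraMap A K a = s • x := by
  let : Algebra R K := IsLocalization.localizationAlgebraOfSubmonoidLe R K S A⁰ hS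
  have : IsScalarTower A R K :=
    IsLocalization.localization_isScalarTower_of_submonoid_le R K S A⁰ hS
  have : IsFractionRing R K := IsFractionRing.isFractionRing_of_isLocalization S R K hS
  rw [isIntegrallyClosed_iff K]
  constructor
  · intro h x hx
    obtain ⟨y, rfl⟩ := h (hx.tower_top (A := R))
    obtain ⟨⟨a, s⟩, hy⟩ := IsLocalization.surj S y
    refine ⟨s, s.2, a, ?_⟩
    rw [Algebra.smul_def, IsScalarTower.algebraMap_apply A R K, IsScalarTower.algebraMap_apply A R K,
      ← map_mul, mul_comm, hy]
  · intro h x hx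
    obtain ⟨s, hs⟩ := hx.exists_multiple_integral_of_isLocalization S
    obtain ⟨t, ht, a, ha⟩ := h _ hs
    refine ⟨IsLocalization.mk' R a (⟨t, ht⟩ * s), ?_⟩
    have hne : algebraMap A K (t * s) ≠ 0 :=
      IsFractionRing.to_map_ne_zero_of_mem_nonZeroDivisors (hS (mul_mem ht s.2))
    apply mul_left_cancel₀ hne
    calc algebraMap A K (t * s) * algebraMap R K (IsLocalization.mk' R a (⟨t, ht⟩ * s))
        = algebraMap R K (algebraMap A R (⟨t, ht⟩ * s : S) *
            IsLocalization.mk' R a (⟨t, ht⟩ * s)) := by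
          rw [map_mul (algebraMap R K), ← IsScalarTower.algebraMap_apply A R K]; rfl
      _ = algebraMap A K a := by
          rw [IsLocalization.mk'_spec', ← IsScalarTower.algebraMap_apply A R K]
      _ = algebraMap A K (t * s) * x := by
          rw [ha, Submonoid.smul_def, smul_smul, Algebra.smul_def]

/-- The ideal of all `a` such that `a / f` is integral over `A`. -/
noncomputable def integralNumerators {A : Type*} (K : Type*) [CommRing A] [Field K] [Algebra A K]
    (f : A) : Ideal A :=
  (Subalgebra.toSubmodule (integralClosure A K)).comap
    (LinearMap.toSpanSingleton A K (algebraMap A K f)⁻¹)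

theorem mem_integralNumerators {A K : Type*} [CommRing A] [Field K] [Algebra A K] {f a : A} :
    a ∈ integralNumerators K f ↔ IsIntegral A (algebraMap A K a / algebraMap A K f) := by
  simp [integralNumerators, mem_integralClosure_iff, Algebra.smul_def, div_eq_mul_inv]

/-- If `s` multiplies the numerators of integral fractions with denominator `f` into `(f)`, then
powers of `s` clear the denominators of integral fractions whose denominator is a power of `f`. -/
theorem exists_algebraMap_eq_pow_smul_of_mem_colon {A K : Type*} [CommRing A] [Field K]
    [Algebra A K] {f s : A} (hf : algebraMap A K f ≠ 0)
    (hs : s ∈ (Ideal.span {f}).colon (integralNumerators K f : Set A)) (n : ℕ) {x : K}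
    (hx : IsIntegral A x) (h : ∃ a : A, algebraMap A K a = f ^ n • x) :
    ∃ a : A, algebraMap A K a = s ^ n • x := by
  induction n generalizing x with
  | zero => simpa using h
  | succ n ih =>
    obtain ⟨a, ha⟩ := h
    have hdiv : algebraMap A K a / algebraMap A K f = f ^ n • x := by
      rw [ha, pow_succ', mul_smul, Algebra.smul_def f, mul_div_cancel_left₀ _ hf]
    have hmem : a ∈ integralNumerators K f := by
      rw [mem_integralNumerators, hdiv]
      exact hx.smul _
    obtain ⟨b, hb⟩ := Ideal.mem_span_singleton.mp (Submodule.mem_colon.mp hs a hmem)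
    obtain ⟨c, hc⟩ := ih (hx.smul s) ⟨b, by
      rw [smul_comm, ← hdiv, Algebra.smul_def, ← mul_div_assoc, ← map_mul, ← smul_eq_mul, hb,
        map_mul, mul_div_cancel_left₀ _ hf]⟩
    exact ⟨c, by rw [hc, pow_succ, mul_smul]⟩

/-- A finitely generated ideal that is pointwise multiplied into `J` by elements outside a prime
`p` is multiplied into `J` by a single element outside `p`. -/
theorem Ideal.exists_mem_colon_notMem_of_fg {A : Type*} [CommRing A] {I J p : Ideal A} [p.IsPrime]
    (hI : I.FG) (h : ∀ a ∈ I, ∃ s ∉ p, s * a ∈ J) : ∃ s ∈ J.colon (I : Set A), s ∉ p := by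
  classical
  obtain ⟨T, rfl⟩ := hI
  choose! s hsp hsJ using h
  refine ⟨∏ a ∈ T, s a, Submodule.mem_colon.mpr fun a ha ↦ ?_, ?_⟩
  · induction ha using Submodule.span_induction with
    | mem a ha =>
      rw [← Finset.mul_prod_erase T s ha, smul_eq_mul, mul_right_comm]
      exact J.mul_mem_right _ (hsJ a (Ideal.subset_span ha))
    | zero => simp
    | add a b _ _ ha hb => rw [smul_add]; exact J.add_mem ha hb
    | smul c a _ ha => rw [smul_comm]; exact J.smul_mem c ha
  · rw [Ideal.IsPrime.prod_mem_iff]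
    rintro ⟨a, ha, hap⟩
    exact hsp a (Ideal.subset_span ha) hap

/-- Let `A` be a Noetherian integral domain. If there is a nonzero `f ∈ A`
such that the localization `A[1/f]` is normal (integrally closed), then the normal locus
`Nor(Spec A) = { 𝔭 : A_𝔭 is integrally closed }` is open in `Spec A`. -/
theorem normal_locus_isOpen_of_localization_away_normal
    (A : Type*) [CommRing A] [IsDomain A] [IsNoetherianRing A]
    (f : A) (hf : f ≠ 0) (hnormal : IsIntegrallyClosed (Localization.Away f)) :
    IsOpen {p : PrimeSpectrum A | IsIntegrallyClosed (Localization.AtPrime p.asIdeal)} := by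
  let K := FractionRing A
  have hfK : algebraMap A K f ≠ 0 := by simpa using hf
  rw [IsLocalization.isIntegrallyClosed_iff_exists_smul_mem K (Submonoid.powers f)
    (powers_le_nonZeroDivisors_of_noZeroDivisors hf)] at hnormal
  suffices {p : PrimeSpectrum A | IsIntegrallyClosed (Localization.AtPrime p.asIdeal)} =
      (PrimeSpectrum.zeroLocus
        ((Ideal.span {f}).colon (integralNumerators K f : Set A) : Set A))ᶜ from
    this ▸ (PrimeSpectrum.isClosed_zeroLocus _).isOpen_compl
  ext p
  rw [Set.mem_ofPred_eq, IsLocalization.isIntegrallyClosed_iff_exists_smul_mem K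
    p.asIdeal.primeCompl p.asIdeal.primeCompl_le_nonZeroDivisors, Set.mem_compl_iff,
    PrimeSpectrum.mem_zeroLocus, Set.not_subset]
  constructor
  · intro h
    refine Ideal.exists_mem_colon_notMem_of_fg (IsNoetherian.noetherian _) fun a ha ↦ ?_
    obtain ⟨s, hs, b, hb⟩ := h _ (mem_integralNumerators.mp ha)
    refine ⟨s, hs, Ideal.mem_span_singleton.mpr ⟨b, IsFractionRing.injective A K ?_⟩⟩
    rw [map_mul, map_mul, hb, Algebra.smul_def]
    rw [mul_left_comm, mul_div_cancel₀ _ hfK]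
  · rintro ⟨s, hs, hsp⟩ x hx
    obtain ⟨_, ⟨n, rfl⟩, hn⟩ := hnormal x hx
    exact ⟨s ^ n, p.asIdeal.primeCompl.pow_mem hsp n,
      exists_algebraMap_eq_pow_smul_of_mem_colon hfK hs n hx hn⟩
end

section
/- Let A be a Noetherian integral domain that is N-1, i.e. the integral closure of A in its fraction field is a finitely generated A-module. Then the normal locus Nor(Spec A) = { 𝔭 ∈ Spec A : the localization A_𝔭 is integrally closed in the fraction field of A } is an open subset of Spec A. -/
/-- For a localization `B` of `A` inside the fraction field `K`, being integrally closed means that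
every element of `K` integral over `A` has a multiple in `A` by an element of the submonoid. -/
theorem IsLocalization.isIntegrallyClosed_iff_exists_smul_mem_range
    {A : Type*} [CommRing A] (M : Submonoid A) (B : Type*) [CommRing B]
    [Algebra A B] [IsLocalization M B] (K : Type*) [Field K] [Algebra A K] [Algebra B K]
    [IsScalarTower A B K] [IsFractionRing B K] :
    IsIntegrallyClosed B ↔
      ∀ x : K, IsIntegral A x → ∃ s ∈ M, ∃ a : A, algebraMap A K a = s • x := by
  rw [isIntegrallyClosed_iff K]
  constructor
  · intro h x hx
    obtain ⟨b, rfl⟩ := h hx.tower_top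
    obtain ⟨⟨a, s⟩, has⟩ := IsLocalization.surj M b
    refine ⟨s, s.2, a, ?_⟩
    rw [IsScalarTower.algebraMap_apply A B K, ← has, map_mul, mul_comm, Algebra.smul_def,
      IsScalarTower.algebraMap_apply A B K]
  · intro h x hx
    obtain ⟨m, hm⟩ := hx.exists_multiple_integral_of_isLocalization M x
    obtain ⟨s, hs, a, ha⟩ := h _ hm
    have hu : IsUnit (algebraMap A B (s * m)) :=
      IsLocalization.map_units B (⟨s * m, M.mul_mem hs m.2⟩ : M)
    refine ⟨IsLocalization.mk' B a (⟨s * m, M.mul_mem hs m.2⟩ : M), ?_⟩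
    have hu' := hu.map (algebraMap B K)
    apply hu'.mul_left_cancel
    rw [← map_mul, IsLocalization.mk'_spec'_mk, ← IsScalarTower.algebraMap_apply, ha,
      ← IsScalarTower.algebraMap_apply, map_mul, Submonoid.smul_def, Algebra.smul_def,
      Algebra.smul_def, mul_assoc]

/-- The non-normal locus is the support of the integral closure modulo the base ring. -/
theorem PrimeSpectrum.isIntegrallyClosed_localization_iff_notMem_support
    {A : Type*} [CommRing A] [IsDomain A] (K : Type*) [Field K] [Algebra A K]
    [IsFractionRing A K] (p : PrimeSpectrum A) :
    IsIntegrallyClosed (Localization.AtPrime p.asIdeal) ↔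
      p ∉ Module.support A
        (integralClosure A K ⧸ LinearMap.range (Algebra.linearMap A (integralClosure A K))) := by
  have hle := p.asIdeal.primeCompl_le_nonZeroDivisors
  let _ := IsLocalization.localizationAlgebraOfSubmonoidLe (Localization.AtPrime p.asIdeal) K
    p.asIdeal.primeCompl (nonZeroDivisors A) hle
  have := IsLocalization.localization_isScalarTower_of_submonoid_le
    (Localization.AtPrime p.asIdeal) K p.asIdeal.primeCompl (nonZeroDivisors A) hle
  have := IsFractionRing.isFractionRing_of_isDomain_of_isLocalization p.asIdeal.primeCompl
    (Localization.AtPrime p.asIdeal) K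
  rw [IsLocalization.isIntegrallyClosed_iff_exists_smul_mem_range p.asIdeal.primeCompl _ K,
    Module.notMem_support_iff']
  constructor
  · intro h m
    obtain ⟨x, rfl⟩ := Submodule.mkQ_surjective _ m
    obtain ⟨s, hs, a, ha⟩ := h x x.2
    refine ⟨s, hs, ?_⟩
    rw [← map_smul, Submodule.mkQ_apply, Submodule.Quotient.mk_eq_zero]
    exact ⟨a, Subtype.ext ha⟩
  · intro h x hx
    obtain ⟨s, hs, hsx⟩ := h (Submodule.mkQ _ ⟨x, hx⟩)
    rw [← map_smul, Submodule.mkQ_apply, Submodule.Quotient.mk_eq_zero] at hsx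
    obtain ⟨a, ha⟩ := hsx
    exact ⟨s, hs, a, congrArg Subtype.val ha⟩

/-- Let `A` be a Noetherian integral domain which is N-1, i.e. the
integral closure of `A` in its fraction field is a finitely generated `A`-module. Then the
normal locus `Nor(Spec A) = { 𝔭 : A_𝔭 is integrally closed }` is open in `Spec A`. -/
theorem normal_locus_isOpen_of_N1
    (A : Type*) [CommRing A] [IsDomain A] [IsNoetherianRing A]
    (K : Type*) [Field K] [Algebra A K] [IsFractionRing A K]
    (hN1 : Module.Finite A (integralClosure A K)) :
    IsOpen {p : PrimeSpectrum A | IsIntegrallyClosed (Localization.AtPrime p.asIdeal)} := by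
  simp_rw [PrimeSpectrum.isIntegrallyClosed_localization_iff_notMem_support K]
  rw [← Set.compl_ofPred, Set.ofPred_mem_eq, isOpen_compl_iff, Module.support_eq_zeroLocus]
  exact PrimeSpectrum.isClosed_zeroLocus _
end

section
/- Let K be a field, A a valuation ring of K (a subring such that for every nonzero x ∈ K either x ∈ A or x⁻¹ ∈ A), and L a finite field extension of K. Let O_1, …, O_r be pairwise distinct valuation rings of L, with no inclusion relations among them, such that O_i ∩ K = A for each i. Then Σ_{i=1}^{r} e_i f_i ≤ [L:K], where e_i = [Γ_{w_i} : Γ_v] is the index of the value group of A in the value group of O_i, and f_i = [κ(O_i) : κ(A)] is the degree of the residue field of O_i over the residue field of A. -/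
/-- In a field, at most one prime `p` satisfies `1 + t + ⋯ + t ^ (p - 1) = 0`. -/
theorem eq_of_prime_of_geom_sum_eq_zero {k : Type*} [Field k] {t : k} {p q : ℕ}
    (hp : p.Prime) (hq : q.Prime) (h : ∑ j ∈ Finset.range p, t ^ j = 0)
    (h' : ∑ j ∈ Finset.range q, t ^ j = 0) : p = q := by
  by_contra hpq
  have hco : p.Coprime q := (Nat.coprime_primes hp hq).2 hpq
  have key : ∀ n : ℕ, ∑ j ∈ Finset.range n, t ^ j = 0 → t ^ n = 1 := fun n hn => by
    have := geom_sum_mul t n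
    rw [hn, zero_mul] at this
    exact (sub_eq_zero.1 this.symm)
  have ht : t = 1 := by
    have h1 := orderOf_dvd_of_pow_eq_one (key p h)
    have h2 := orderOf_dvd_of_pow_eq_one (key q h')
    have := Nat.dvd_gcd h1 h2
    rw [hco] at this
    exact orderOf_eq_one_iff.1 (Nat.dvd_one.1 this)
  subst ht
  simp only [one_pow, Finset.sum_const, Finset.card_range, nsmul_eq_mul, mul_one] at h h'
  have hb := Nat.isCoprime_iff_coprime.2 hco
  obtain ⟨a, b, hab⟩ := hb
  have := congrArg (Int.cast : ℤ → k) hab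
  push_cast at this
  rw [h, h'] at this
  simp at this

namespace Valuation

variable {L Γ : Type*} [Field L] [LinearOrderedCommGroupWithZero Γ]

theorem map_geom_sum_le_one (u : Valuation L Γ) {t : L} (ht : u t ≤ 1) (n : ℕ) :
    u (∑ j ∈ Finset.range n, t ^ j) ≤ 1 :=
  u.map_sum_le fun j _ => by rw [map_pow]; exact pow_le_one' ht j

theorem eq_of_prime_of_map_geom_sum_lt_one (u : Valuation L Γ) {t : L} (ht : u t ≤ 1) {p q : ℕ}
    (hp : p.Prime) (hq : q.Prime) (h : u (∑ j ∈ Finset.range p, t ^ j) < 1)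
    (h' : u (∑ j ∈ Finset.range q, t ^ j) < 1) : p = q := by
  let T : u.valuationSubring := ⟨t, ht⟩
  have key : ∀ n : ℕ, u (∑ j ∈ Finset.range n, t ^ j) < 1 →
      ∑ j ∈ Finset.range n, IsLocalRing.residue u.valuationSubring T ^ j = 0 := fun n hn => by
    have hz : IsLocalRing.residue u.valuationSubring (∑ j ∈ Finset.range n, T ^ j) = 0 := by
      rw [IsLocalRing.residue_eq_zero_iff, IsLocalRing.mem_maximalIdeal, mem_nonunits_iff]
      intro hunit
      obtain ⟨s, hs⟩ := hunit.exists_right_inv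
      have hs' := congrArg (fun a : u.valuationSubring => u (a : L)) hs
      have hs1 : u (s : L) ≤ 1 := s.2
      simp only [MulMemClass.coe_mul, AddSubmonoidClass.coe_finsetSum, SubmonoidClass.coe_pow,
        OneMemClass.coe_one, map_mul, map_one] at hs'
      exact (mul_lt_one_of_lt_of_le hn hs1).ne hs'
    simpa using hz
  exact eq_of_prime_of_geom_sum_eq_zero hp hq (key p h) (key q h')

theorem le_map_geom_sum (u : Valuation L Γ) {t : L} (ht : 1 < u t) (n : ℕ) :
    u t ≤ u (∑ j ∈ Finset.range (n + 2), t ^ j) := by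
  have step : ∀ m : ℕ, 1 ≤ u (∑ j ∈ Finset.range m, t ^ j) →
      u t ≤ u (∑ j ∈ Finset.range (m + 1), t ^ j) := fun m hm => by
    have h1 : u t ≤ u (t * ∑ j ∈ Finset.range m, t ^ j) := by
      rw [map_mul]; exact le_mul_of_one_le_right' hm
    rw [geom_sum_succ, u.map_add_eq_of_lt_left (by rw [map_one]; exact ht.trans_le h1)]
    exact h1
  induction n with
  | zero => exact step 1 (by simp)
  | succ n ih => exact step _ (ht.le.trans ih)

/-- For finitely many valuations and any `t`, some `z` is a unit wherever `t` is integral and has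
value at most that of `t⁻¹` elsewhere. -/
theorem exists_map_eq_one_and_map_le_inv {ι : Type*} [Finite ι] (u : ι → Valuation L Γ) (t : L) :
    ∃ z : L, ∀ l, (u l t ≤ 1 → u l z = 1) ∧ (1 < u l t → u l z ≤ (u l t)⁻¹) := by
  let bad : ι → Set ℕ := fun l =>
    {p | p.Prime ∧ u l t ≤ 1 ∧ u l (∑ j ∈ Finset.range p, t ^ j) < 1}
  have hbad : (⋃ l, bad l).Finite := Set.finite_iUnion fun l => Set.Subsingleton.finite
    fun p hp q hq => eq_of_prime_of_map_geom_sum_lt_one _ hp.2.1 hp.1 hq.1 hp.2.2 hq.2.2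
  obtain ⟨p, hp, hpb⟩ := Nat.infinite_setOfPred_prime.exists_notMem_finite hbad
  refine ⟨(∑ j ∈ Finset.range p, t ^ j)⁻¹, fun l => ⟨fun h => ?_, fun h => ?_⟩⟩
  · rw [map_inv₀, inv_eq_one]
    refine le_antisymm (map_geom_sum_le_one _ h _) (not_lt.1 fun hlt => hpb ?_)
    exact Set.mem_iUnion.2 ⟨l, hp, h, hlt⟩
  · obtain ⟨n, rfl⟩ := Nat.exists_eq_add_of_le' (Nat.Prime.two_le hp)
    rw [map_inv₀]
    exact inv_anti₀ (zero_lt_one.trans h) (le_map_geom_sum _ h n)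

variable {K : Type*} [Field K] [Algebra K L] {v : Valuation K Γ}

theorem exists_le_one_and_lt {u u' : Valuation L Γ} (hv : Function.Surjective v) {N : ℕ}
    (hN : N ≠ 0) (hu : ∀ c, u (algebraMap K L c) = v c ^ N)
    (hu' : ∀ c, u' (algebraMap K L c) = v c ^ N) (h : ∃ t, u t ≤ 1 ∧ 1 < u' t) {x : L}
    (hx : x ≠ 0) : ∃ t, u t ≤ 1 ∧ 1 < u' t ∧ (u' t)⁻¹ * u' x < u x := by
  obtain ⟨t, ht, ht'⟩ := h
  have hx0 : u x ≠ 0 := (u.ne_zero_iff).2 hx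
  have hx0' : u' x ≠ 0 := (u'.ne_zero_iff).2 hx
  rcases lt_or_ge (u x) (u' x) with hlt | hle
  · obtain ⟨c, hc⟩ := hv (u x)
    have e : u (x ^ N / algebraMap K L c * t) = u t := by
      rw [map_mul, map_div₀, hu, map_pow, hc, div_self (pow_ne_zero _ hx0), one_mul]
    have e' : u' (x ^ N / algebraMap K L c * t) = (u' x / u x) ^ N * u' t := by
      rw [map_mul, map_div₀, hu', map_pow, hc, div_pow]
    have h1 : 1 < u' x / u x := (one_lt_div₀ (zero_lt_iff.2 hx0)).2 hlt
    have h2 : u' x / u x < (u' x / u x) ^ N * u' t :=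
      (le_self_pow h1.le hN).trans_lt (lt_mul_of_one_lt_right (zero_lt_one.trans
        (one_lt_pow₀ h1 hN)) ht')
    refine ⟨x ^ N / algebraMap K L c * t, e ▸ ht, e' ▸ h1.trans h2, ?_⟩
    have hpos := zero_lt_one.trans (h1.trans h2)
    rw [e']
    rw [div_lt_iff₀ (zero_lt_iff.2 hx0)] at h2
    rw [inv_mul_lt_iff₀ hpos]
    exact h2
  · refine ⟨t, ht, ht', lt_of_lt_of_le ?_ hle⟩
    exact mul_lt_of_lt_one_left (zero_lt_iff.2 hx0') (inv_lt_one_of_one_lt₀ ht')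

/-- Finitely many nonzero elements can be multiplied by a common `u i`-unit so as to make their
values under the other valuations smaller than the one under `u i`. -/
theorem exists_map_eq_one_and_mul_lt {ι : Type*} [Finite ι] {u : ι → Valuation L Γ}
    (hv : Function.Surjective v) {N : ℕ} (hN : N ≠ 0)
    (hu : ∀ i c, u i (algebraMap K L c) = v c ^ N)
    (hinc : ∀ i k, i ≠ k → ∃ t, u i t ≤ 1 ∧ 1 < u k t) (i : ι) {X : Type*} [Finite X]
    (x : X → L) (hx : ∀ a, x a ≠ 0) :
    ∃ z : L, u i z = 1 ∧ ∀ k, k ≠ i → ∀ a, u k (z * x a) < u i (z * x a) := by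
  have pair : ∀ m : {k // k ≠ i} × X, ∃ z : L, u i z = 1 ∧ (∀ l, u l z ≤ 1) ∧
      u m.1 z * u m.1 (x m.2) < u i (x m.2) := by
    rintro ⟨⟨k, hk⟩, a⟩
    obtain ⟨t, ht, ht', hlt⟩ :=
      exists_le_one_and_lt hv hN (hu i) (hu k) (hinc i k hk.symm) (hx a)
    obtain ⟨z, hz⟩ := exists_map_eq_one_and_map_le_inv u t
    refine ⟨z, (hz i).1 ht, fun l => ?_, (mul_le_mul_left ((hz k).2 ht') _).trans_lt hlt⟩
    rcases le_or_gt (u l t) 1 with h | h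
    · exact ((hz l).1 h).le
    · exact ((hz l).2 h).trans (inv_le_one_of_one_le₀ h.le)
  choose z hz1 hz2 hz3 using pair
  have := Fintype.ofFinite X
  have := Fintype.ofFinite {k // k ≠ i}
  have hprod : u i (∏ m, z m) = 1 := by
    rw [map_prod]; exact Finset.prod_eq_one fun m _ => hz1 m
  refine ⟨∏ m, z m, hprod, fun k hk a => ?_⟩
  rw [map_mul, map_mul, hprod, one_mul]
  refine lt_of_le_of_lt (mul_le_mul_left ?_ _) (hz3 (⟨k, hk⟩, a))
  classical
  rw [map_prod, ← Finset.mul_prod_erase _ _ (Finset.mem_univ ((⟨k, hk⟩, a) : {k // k ≠ i} × X))]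
  exact mul_le_of_le_one_right' (Finset.prod_le_one' fun m _ => hz2 m k)

/-- Abstract form of the fundamental inequality, for valuations with values in one common group:
a family of representatives of distinct cosets of values, times a family whose residues are
linearly independent, contributes to the degree, and the contributions of incomparable valuations
add up. -/
theorem sum_card_mul_card_le_finrank [FiniteDimensional K L] {ι : Type*} [Fintype ι]
    {u : ι → Valuation L Γ} (hv : Function.Surjective v) {N : ℕ} (hN : N ≠ 0)
    (hu : ∀ i c, u i (algebraMap K L c) = v c ^ N)
    (hinc : ∀ i k, i ≠ k → ∃ t, u i t ≤ 1 ∧ 1 < u k t)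
    {S J : ι → Type*} [∀ i, Fintype (S i)] [∀ i, Fintype (J i)]
    (π : ∀ i, S i → L) (b : ∀ i, J i → L) (hπ0 : ∀ i s, π i s ≠ 0)
    (hπ : ∀ i s s', s ≠ s' → ∀ c c' : K, c ≠ 0 →
      u i (algebraMap K L c * π i s) ≠ u i (algebraMap K L c' * π i s'))
    (hb : ∀ i (a : J i → K) (j₀ : J i), (∀ j, v (a j) ≤ 1) → a j₀ = 1 →
      u i (∑ j, algebraMap K L (a j) * b i j) = 1) :
    ∑ i, Fintype.card (S i) * Fintype.card (J i) ≤ Module.finrank K L := by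
  classical
  have hb1 : ∀ i j, u i (b i j) = 1 := fun i j => by
    have := hb i (Pi.single j 1) j (fun j' => by
      by_cases h : j' = j
      · subst h; simp
      · simp [h]) (by simp)
    rw [Finset.sum_eq_single j (fun j' _ h => by simp [h]) (by simp)] at this
    simpa using this
  have hx0 : ∀ i (a : S i × J i), π i a.1 * b i a.2 ≠ 0 := fun i a =>
    mul_ne_zero (hπ0 i a.1) ((u i).ne_zero_iff.1 (by rw [hb1]; exact one_ne_zero))
  choose z hz1 hz2 using fun i =>
    exists_map_eq_one_and_mul_lt hv hN hu hinc i (fun a : S i × J i => π i a.1 * b i a.2) (hx0 i)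
  let X : (Σ i, S i × J i) → L := fun m => z m.1 * (π m.1 m.2.1 * b m.1 m.2.2)
  suffices hli : LinearIndependent K X by
    simpa [Fintype.card_sigma, Fintype.card_prod] using hli.fintype_card_le_finrank
  rw [Fintype.linearIndependent_iff]
  intro g hg m
  by_contra hgm
  let f : (Σ i, S i × J i) → Γ := fun m => u m.1 (g m • X m)
  have hf : ∀ m, f m = u m.1 (algebraMap K L (g m) * π m.1 m.2.1) := fun m => by
    simp only [f, X, Algebra.smul_def, map_mul, hz1, hb1, one_mul, mul_one]
  have : Nonempty (Σ i, S i × J i) := ⟨m⟩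
  obtain ⟨⟨i₀, s₀, j₀⟩, hmax⟩ := Finite.exists_max f
  have hfpos : 0 < f ⟨i₀, s₀, j₀⟩ := by
    refine lt_of_lt_of_le (zero_lt_iff.2 ?_) (hmax m)
    rw [hf, (u _).ne_zero_iff]
    exact mul_ne_zero (by simpa using hgm) (hπ0 _ _)
  have hg0 : g ⟨i₀, s₀, j₀⟩ ≠ 0 := fun h => by
    rw [hf] at hfpos
    simp [h] at hfpos
  have hP : u i₀ (∑ j, g ⟨i₀, s₀, j⟩ • X ⟨i₀, s₀, j⟩) = f ⟨i₀, s₀, j₀⟩ := by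
    have e : ∑ j, g ⟨i₀, s₀, j⟩ • X ⟨i₀, s₀, j⟩ =
        z i₀ * (algebraMap K L (g ⟨i₀, s₀, j₀⟩) * π i₀ s₀) *
          ∑ j, algebraMap K L (g ⟨i₀, s₀, j⟩ / g ⟨i₀, s₀, j₀⟩) * b i₀ j := by
      rw [Finset.mul_sum]
      refine Finset.sum_congr rfl fun j _ => ?_
      have : algebraMap K L (g ⟨i₀, s₀, j₀⟩) ≠ 0 := by simpa using hg0
      simp only [X, Algebra.smul_def, map_div₀]
      field_simp
    rw [e, map_mul, map_mul, hz1, one_mul, hf, hb i₀ _ j₀ (fun j => ?_) (div_self hg0), mul_one]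
    have h := hmax ⟨i₀, s₀, j⟩
    rw [hf, hf] at h
    simp only [map_mul, hu] at h
    have h' := le_of_mul_le_mul_right h (zero_lt_iff.2 ((u i₀).ne_zero_iff.2 (hπ0 i₀ s₀)))
    rw [map_div₀]
    exact div_le_one_of_le₀ ((pow_le_pow_iff_left₀ zero_le zero_le hN).1 h') zero_le
  have hR₁ : u i₀ (∑ s ∈ Finset.univ.erase s₀, ∑ j, g ⟨i₀, s, j⟩ • X ⟨i₀, s, j⟩) <
      f ⟨i₀, s₀, j₀⟩ := by
    refine (u i₀).map_sum_lt hfpos.ne' fun s hs => (u i₀).map_sum_lt hfpos.ne' fun j _ => ?_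
    refine lt_of_le_of_ne (hmax ⟨i₀, s, j⟩) fun h => ?_
    change f ⟨i₀, s, j⟩ = f ⟨i₀, s₀, j₀⟩ at h
    rw [hf, hf] at h
    exact hπ i₀ s₀ s (Finset.ne_of_mem_erase hs).symm _ _ hg0 h.symm
  have hR₂ : u i₀ (∑ i ∈ Finset.univ.erase i₀, ∑ a, g ⟨i, a⟩ • X ⟨i, a⟩) < f ⟨i₀, s₀, j₀⟩ := by
    refine (u i₀).map_sum_lt hfpos.ne' fun i hi => (u i₀).map_sum_lt hfpos.ne' fun a _ => ?_
    by_cases h0 : g ⟨i, a⟩ = 0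
    · simpa [h0] using hfpos
    · refine lt_of_lt_of_le ?_ (hmax ⟨i, a⟩)
      simp only [f, Algebra.smul_def]
      rw [(u i₀).map_mul _ (X _), (u i).map_mul _ (X _), hu, hu]
      exact mul_lt_mul_of_pos_left (hz2 i i₀ (Finset.ne_of_mem_erase hi).symm a)
        (zero_lt_iff.2 (pow_ne_zero _ (v.ne_zero_iff.2 h0)))
  rw [Fintype.sum_sigma, ← Finset.add_sum_erase _ _ (Finset.mem_univ i₀), Fintype.sum_prod_type,
    ← Finset.add_sum_erase _ _ (Finset.mem_univ s₀), add_assoc] at hg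
  have hlt := (u i₀).map_add_lt hR₁ hR₂
  rw [← hP, ← (u i₀).map_neg, ← eq_neg_of_add_eq_zero_left hg] at hlt
  exact lt_irrefl _ hlt

end Valuation

namespace ValuationSubring

variable {K L : Type*} [Field K] [Field L] [Algebra K L]

theorem valuation_algebraMap_le_iff {A : ValuationSubring K} {O : ValuationSubring L}
    (h : O.comap (algebraMap K L) = A) (c d : K) :
    O.valuation (algebraMap K L c) ≤ O.valuation (algebraMap K L d) ↔
      A.valuation c ≤ A.valuation d := by
  have h1 : ∀ c : K, O.valuation (algebraMap K L c) ≤ 1 ↔ A.valuation c ≤ 1 := fun c => by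
    rw [valuation_le_one_iff, valuation_le_one_iff, ← h, mem_comap]
  by_cases hd : d = 0
  · subst hd
    simp
  · have hd' : algebraMap K L d ≠ 0 := by simpa using hd
    rw [← div_le_one₀ (zero_lt_iff.2 (O.valuation.ne_zero_iff.2 hd')),
      ← div_le_one₀ (zero_lt_iff.2 (A.valuation.ne_zero_iff.2 hd)), ← map_div₀, ← map_div₀,
      ← map_div₀, h1]

/-- If `N` annihilates the quotient of value groups, the valuation of `O` can be renormalized
to take its values in the value group of `A`. -/
theorem exists_valuation_valueGroup {A : ValuationSubring K} {O : ValuationSubring L}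
    (h : O.comap (algebraMap K L) = A) {N : ℕ} (hN : N ≠ 0)
    (hO : ∀ y : L, y ≠ 0 → ∃ c : K, O.valuation (y ^ N) = O.valuation (algebraMap K L c)) :
    ∃ u : Valuation L A.ValueGroup, (∀ c, u (algebraMap K L c) = A.valuation c ^ N) ∧
      ∀ x y, u x ≤ u y ↔ O.valuation x ≤ O.valuation y := by
  have hO' : ∀ y : L, ∃ c : K, O.valuation y ^ N = O.valuation (algebraMap K L c) := fun y => by
    by_cases hy : y = 0
    · exact ⟨0, by simp [hy, hN]⟩
    · simpa using hO y hy
  choose a ha using hO'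
  have hle : ∀ x y, A.valuation (a x) ≤ A.valuation (a y) ↔ O.valuation x ≤ O.valuation y :=
    fun x y => by
      rw [← valuation_algebraMap_le_iff h, ← ha, ← ha, pow_le_pow_iff_left₀ zero_le zero_le hN]
  have heq : ∀ c d : K, O.valuation (algebraMap K L c) = O.valuation (algebraMap K L d) →
      A.valuation c = A.valuation d := fun c d hcd =>
    le_antisymm ((valuation_algebraMap_le_iff h c d).1 hcd.le)
      ((valuation_algebraMap_le_iff h d c).1 hcd.ge)
  refine ⟨{ toFun := fun y => A.valuation (a y)
            map_zero' := ?_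
            map_one' := ?_
            map_mul' := fun x y => ?_
            map_add_le_max' := fun x y => ?_ }, fun c => ?_, hle⟩
  · rw [heq (a 0) 0 (by rw [← ha]; simp [hN]), map_zero]
  · rw [heq (a 1) 1 (by rw [← ha]; simp), map_one]
  · rw [← map_mul]
    refine heq _ _ ?_
    rw [← ha, map_mul, map_mul, map_mul, ← ha, ← ha, mul_pow]
  · rw [le_max_iff, hle, hle, ← le_max_iff]
    exact O.valuation.map_add x y
  · change A.valuation (a _) = _
    rw [← map_pow]
    refine heq _ _ ?_
    rw [← ha, map_pow, map_pow]

theorem mk_mem_map_range_iff (O : ValuationSubring L) (y : Lˣ) :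
    QuotientGroup.mk' O.unitGroup y ∈ Subgroup.map (QuotientGroup.mk' O.unitGroup)
      (MonoidHom.range (Units.map (algebraMap K L).toMonoidHom)) ↔
      ∃ c : K, O.valuation (y : L) = O.valuation (algebraMap K L c) := by
  constructor
  · rintro ⟨-, ⟨c, rfl⟩, hc⟩
    rw [QuotientGroup.mk'_apply, QuotientGroup.mk'_apply, QuotientGroup.eq,
      mem_unitGroup_iff] at hc
    refine ⟨c, ?_⟩
    have h : ((y : Lˣ) : L) = algebraMap K L c *
      ((((Units.map (algebraMap K L).toMonoidHom c)⁻¹ * y : Lˣ)) : L) := by simp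
    rw [h, map_mul, hc, mul_one]
  · rintro ⟨c, hc⟩
    have hc0 : c ≠ 0 := fun h0 => by simp [h0] at hc
    refine ⟨_, ⟨Units.mk0 c hc0, rfl⟩, ?_⟩
    rw [QuotientGroup.mk'_apply, QuotientGroup.mk'_apply, QuotientGroup.eq, mem_unitGroup_iff]
    have hv : O.valuation (algebraMap K L c) ≠ 0 := hc ▸ O.valuation.ne_zero_iff.2 y.ne_zero
    simp [hc, hv]

/-- Lifts of linearly independent residues satisfy the Gauss-norm property. -/
theorem valuation_sum_eq_one {A : ValuationSubring K} {O : ValuationSubring L} (φ : A →+* O)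
    (hφ : ∀ x : A, (φ x : L) = algebraMap K L (x : K)) [IsLocalHom φ] {J : Type*} [Fintype J]
    (b : J → O)
    (hb : letI := (IsLocalRing.ResidueField.map φ).toAlgebra
      LinearIndependent (IsLocalRing.ResidueField A) fun j => IsLocalRing.residue O (b j))
    (a : J → K) (j₀ : J) (ha : ∀ j, A.valuation (a j) ≤ 1) (ha₀ : a j₀ = 1) :
    O.valuation (∑ j, algebraMap K L (a j) * b j) = 1 := by
  let := (IsLocalRing.ResidueField.map φ).toAlgebra
  let a' : J → A := fun j => ⟨a j, (valuation_le_one_iff A _).1 (ha j)⟩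
  have hsum : ((∑ j, φ (a' j) * b j : O) : L) = ∑ j, algebraMap K L (a j) * b j := by
    simp [hφ, a']
  rw [← hsum]
  refine (valuation_eq_one_iff O _).1 ?_
  by_contra hnu
  rw [← _root_.mem_nonunits_iff, ← IsLocalRing.mem_maximalIdeal, ← IsLocalRing.residue_eq_zero_iff,
    map_sum] at hnu
  have h := Fintype.linearIndependent_iff.1 hb (fun j => IsLocalRing.residue A (a' j))
    (by simpa [Algebra.smul_def, RingHom.algebraMap_toAlgebra] using hnu) j₀
  have h1 : a' j₀ = 1 := Subtype.ext ha₀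
  simp [h1] at h

/-- The fundamental inequality when all terms are nonzero. -/
theorem sum_index_mul_finrank_le_of_ne_zero [FiniteDimensional K L] {A : ValuationSubring K}
    {ι : Type*} [Fintype ι] (O : ι → ValuationSubring L)
    (hnoincl : ∀ i j, i ≠ j → ¬ O i ≤ O j) (hover : ∀ i, (O i).comap (algebraMap K L) = A)
    (φ : ∀ i, A →+* O i) (hφ : ∀ i (x : A), (φ i x : L) = algebraMap K L (x : K))
    (hloc : ∀ i, IsLocalHom (φ i)) (e f : ι → ℕ)
    (he : ∀ i, e i = (Subgroup.map (QuotientGroup.mk' (O i).unitGroup)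
      (MonoidHom.range (Units.map (algebraMap K L).toMonoidHom))).index)
    (hf : ∀ i, f i = (letI := hloc i
      letI := (IsLocalRing.ResidueField.map (φ i)).toAlgebra
      Module.finrank (IsLocalRing.ResidueField A) (IsLocalRing.ResidueField (O i))))
    (he0 : ∀ i, e i ≠ 0) (hf0 : ∀ i, f i ≠ 0) :
    ∑ i, e i * f i ≤ Module.finrank K L := by
  let Q : ι → Type _ := fun i => Lˣ ⧸ (O i).unitGroup
  let H : ∀ i, Subgroup (Q i) := fun i => Subgroup.map (QuotientGroup.mk' (O i).unitGroup)
    (MonoidHom.range (Units.map (algebraMap K L).toMonoidHom))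
  have hN : ∏ i, e i ≠ 0 := Finset.prod_ne_zero_iff.2 fun i _ => he0 i
  have hu : ∀ i, ∃ u : Valuation L A.ValueGroup,
      (∀ c, u (algebraMap K L c) = A.valuation c ^ ∏ i, e i) ∧
      ∀ x y, u x ≤ u y ↔ (O i).valuation x ≤ (O i).valuation y := fun i => by
    refine exists_valuation_valueGroup (hover i) hN fun y hy => ?_
    obtain ⟨m, hm⟩ := Finset.dvd_prod_of_mem e (Finset.mem_univ i)
    refine (mk_mem_map_range_iff (O i) (Units.mk0 y hy ^ ∏ i, e i)).1 ?_
    rw [hm, pow_mul, map_pow, map_pow]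
    refine Subgroup.pow_mem _ ?_ m
    rw [he i]
    exact Subgroup.pow_index_mem _ _
  choose u hu hule using hu
  have hueq : ∀ i x y, u i x = u i y ↔ (O i).valuation x = (O i).valuation y := fun i x y => by
    rw [le_antisymm_iff, le_antisymm_iff, hule, hule]
  have hu1 : ∀ i x, u i x ≤ 1 ↔ x ∈ O i := fun i x => by
    rw [← valuation_le_one_iff, ← map_one (u i), hule, map_one]
  have hfin : ∀ i, Fintype (Q i ⧸ H i) := fun i =>
    Subgroup.fintypeOfIndexNeZero (he i ▸ he0 i)
  have hcardS : ∀ i, Fintype.card (Q i ⧸ H i) = e i := fun i => by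
    rw [he i, Subgroup.index, Nat.card_eq_fintype_card]
  have hπ : ∀ i (s : Q i ⧸ H i), ∃ y : Lˣ,
      QuotientGroup.mk' (H i) (QuotientGroup.mk' (O i).unitGroup y) = s := fun i s => by
    obtain ⟨q, rfl⟩ := QuotientGroup.mk'_surjective _ s
    obtain ⟨y, rfl⟩ := QuotientGroup.mk'_surjective _ q
    exact ⟨y, rfl⟩
  choose π hπ using hπ
  have hb : ∀ i, ∃ b : Fin (f i) → O i,
      letI := hloc i
      letI := (IsLocalRing.ResidueField.map (φ i)).toAlgebra
      LinearIndependent (IsLocalRing.ResidueField A)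
        fun j => IsLocalRing.residue (O i) (b j) := fun i => by
    let := hloc i
    let := (IsLocalRing.ResidueField.map (φ i)).toAlgebra
    have := Module.finite_of_finrank_pos (Nat.pos_of_ne_zero (hf i ▸ hf0 i))
    let B := Module.finBasisOfFinrankEq (IsLocalRing.ResidueField A)
      (IsLocalRing.ResidueField (O i)) (hf i).symm
    choose b hb using fun j => IsLocalRing.residue_surjective (B j)
    exact ⟨b, by simpa only [hb] using B.linearIndependent⟩
  choose b hb using hb
  have key := Valuation.sum_card_mul_card_le_finrank (v := A.valuation) (u := u)
    A.valuation_surjective hN hu (fun i k hik => ?_) (fun i s => (π i s : L))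
    (fun i j => (b i j : L)) (fun i s => (π i s).ne_zero) (fun i s s' hs c c' hc h => hs ?_)
    (fun i a j₀ ha ha₀ => ?_)
  · simpa [hcardS] using key
  · obtain ⟨t, ht, ht'⟩ := SetLike.not_le_iff_exists.1 (hnoincl i k hik)
    exact ⟨t, (hu1 i t).2 ht, not_le.1 fun h => ht' ((hu1 k t).1 h)⟩
  · rw [hueq] at h
    rw [← hπ i s, ← hπ i s']
    refine (QuotientGroup.eq (s := H i)).2 ?_
    rw [← map_inv, ← map_mul]
    refine (mk_mem_map_range_iff (O i) _).2 ?_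
    have hs0 : (O i).valuation (π i s : L) ≠ 0 := (O i).valuation.ne_zero_iff.2 (π i s).ne_zero
    have hc0 : (O i).valuation (algebraMap K L c) ≠ 0 :=
      (O i).valuation.ne_zero_iff.2 (by simpa using hc)
    have hc0' : (O i).valuation (algebraMap K L c') ≠ 0 := fun h0 => by
      rw [map_mul, map_mul, h0, zero_mul] at h
      exact mul_ne_zero hc0 hs0 h
    refine ⟨c / c', ?_⟩
    rw [map_mul, map_mul] at h
    rw [Units.val_mul, Units.val_inv_eq_inv_val, map_mul, map_inv₀, map_div₀, map_div₀,
      eq_div_iff hc0', mul_assoc, inv_mul_eq_iff_eq_mul₀ hs0, mul_comm _ ((O i).valuation _), ← h,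
      mul_comm]
  · have h1 := @valuation_sum_eq_one _ _ _ _ _ _ _ (φ i) (hφ i) (hloc i) _ _ (b i) (hb i) a j₀
      ha ha₀
    rw [← map_one (u i), hueq, h1, map_one]

end ValuationSubring

/-- Let `K` be a field, `A` a valuation ring of `K`, and `L` a finite
field extension of `K`. Let `O 1, …, O r` be pairwise distinct valuation rings of `L`,
with no inclusion relations among them, all lying over `A` (i.e. `O i ∩ K = A`). Then
`Σ e_i f_i ≤ [L:K]`, where `e_i` is the index of (the image of) the value group of `A` in
the value group of `O i`, and `f_i` is the residue class degree. The maps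
`φ i : A → O i` are the (unique) ring homomorphisms induced by `K → L`; they are local,
and induce the residue field extensions `κ(A) → κ(O i)`. -/
theorem sum_ramification_mul_residueDeg_le_finrank_of_valuationSubrings
    (K L : Type*) [Field K] [Field L] [Algebra K L] [FiniteDimensional K L]
    (A : ValuationSubring K) (r : ℕ) (O : Fin r → ValuationSubring L)
    (hdistinct : Function.Injective O)
    (hnoincl : ∀ i j, i ≠ j → ¬ O i ≤ O j)
    (hover : ∀ i, (O i).comap (algebraMap K L) = A)
    (φ : ∀ i, A →+* O i)
    (hφ : ∀ i (x : A), ((φ i x : L)) = algebraMap K L (x : K))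
    (hloc : ∀ i, IsLocalHom (φ i)) :
    ∑ i : Fin r,
      (Subgroup.map (QuotientGroup.mk' (O i).unitGroup)
          (MonoidHom.range (Units.map (algebraMap K L).toMonoidHom))).index *
        (letI := hloc i
         letI := (IsLocalRing.ResidueField.map (φ i)).toAlgebra
         Module.finrank (IsLocalRing.ResidueField A) (IsLocalRing.ResidueField (O i)))
      ≤ Module.finrank K L := by
  classical
  refine le_of_eq_of_le ?_ (ValuationSubring.sum_index_mul_finrank_le_of_ne_zero
    (ι := {i : Fin r // (Subgroup.map (QuotientGroup.mk' (O i).unitGroup)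
          (MonoidHom.range (Units.map (algebraMap K L).toMonoidHom))).index *
        (letI := hloc i
         letI := (IsLocalRing.ResidueField.map (φ i)).toAlgebra
         Module.finrank (IsLocalRing.ResidueField A) (IsLocalRing.ResidueField (O i))) ≠ 0})
    (fun i => O i) (fun i j hij => hnoincl i j fun h => hij (Subtype.ext h))
    (fun i => hover i) (fun i => φ i) (fun i => hφ i) (fun i => hloc i) _ _ (fun _ => rfl)
    (fun _ => rfl) (fun i => left_ne_zero_of_mul i.2) (fun i => right_ne_zero_of_mul i.2))
  rw [← Finset.sum_filter_ne_zero]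
  exact Finset.sum_subtype _ (fun i => by simp) _
end
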